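/- arXiv:2205.07231 — 4 statements merged into one kernel-verified Lean document; each statement's English description precedes it below -/
import Mathlib

section
/- Let M be a positive integer, let K > 0 be real, let a, b > 0, and let y ≥ 0. Then ∫_0^y z^{K−1} e^{−a z} Γ(M, b z) dz = (M−1)! · Σ_{l=0}^{M−1} (b^l / l!) · γ(K+l, (a+b) y) / (a+b)^{K+l}, where Γ(·,·) and γ(·,·) denote the upper and lower incomplete gamma functions. -/
open MeasureTheory Real Set Filter

/-- The upper incomplete gamma function `Γ(s, x) = ∫_x^∞ t^(s-1) e^(-t) dt`. -/
noncomputable def upperGamma (s x : ℝ) : ℝ := ∫ t in Set.Ioi x, t ^ (s - 1) * Real.exp (-t)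

/-- The lower incomplete gamma function `γ(s, x) = ∫_0^x t^(s-1) e^(-t) dt`. -/
noncomputable def lowerGamma (s x : ℝ) : ℝ := ∫ t in (0:ℝ)..x, t ^ (s - 1) * Real.exp (-t)

/-- An antiderivative of `x ^ n * exp (-x)`. -/
theorem hasDerivAt_neg_factorial_mul_sum_mul_exp_neg (n : ℕ) (x : ℝ) :
    HasDerivAt
      (fun t : ℝ => -((n.factorial : ℝ) * (∑ l ∈ Finset.range (n + 1), t ^ l / (l.factorial : ℝ))
        * Real.exp (-t)))
      (x ^ n * Real.exp (-x)) x := by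
  have hexp : HasDerivAt (fun t : ℝ => Real.exp (-t)) (-Real.exp (-x)) x := by
    simpa using (hasDerivAt_neg x).exp
  induction n with
  | zero => simpa using hexp.fun_neg
  | succ n ih =>
    have h := (ih.const_mul ((n : ℝ) + 1)).sub ((hasDerivAt_pow (n + 1) x).mul hexp)
    refine (h.congr_deriv ?_).congr_of_eventuallyEq (Eventually.of_forall fun t => ?_)
    · push_cast
      ring
    · simp only [Pi.sub_apply, Pi.mul_apply]
      rw [Finset.sum_range_succ _ (n + 1), Nat.factorial_succ]
      push_cast
      field_simp
      ring

theorem tendsto_neg_factorial_mul_sum_mul_exp_neg (n : ℕ) :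
    Tendsto
      (fun t : ℝ => -((n.factorial : ℝ) * (∑ l ∈ Finset.range (n + 1), t ^ l / (l.factorial : ℝ))
        * Real.exp (-t))) atTop (nhds 0) := by
  have h : Tendsto (fun t : ℝ => ∑ l ∈ Finset.range (n + 1),
      -(n.factorial : ℝ) / (l.factorial : ℝ) * (t ^ l * Real.exp (-t))) atTop
      (nhds (∑ l ∈ Finset.range (n + 1), -(n.factorial : ℝ) / (l.factorial : ℝ) * 0)) :=
    tendsto_finsetSum _ fun l _ => (tendsto_pow_mul_exp_neg_atTop_nhds_zero l).const_mul _
  simp only [mul_zero, Finset.sum_const_zero] at h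
  refine h.congr fun t => ?_
  rw [Finset.mul_sum, Finset.sum_mul, ← Finset.sum_neg_distrib]
  exact Finset.sum_congr rfl fun l _ => by ring

theorem upperGamma_natCast_add_one (n : ℕ) {x : ℝ} (hx : 0 ≤ x) :
    upperGamma ((n : ℝ) + 1) x
      = (n.factorial : ℝ) * (∑ l ∈ Finset.range (n + 1), x ^ l / (l.factorial : ℝ))
        * Real.exp (-x) := by
  have h := integral_Ioi_of_hasDerivAt_of_nonneg' (a := x)
    (fun t _ => hasDerivAt_neg_factorial_mul_sum_mul_exp_neg n t)
    (fun t ht => mul_nonneg (pow_nonneg (hx.trans (le_of_lt ht)) n) (Real.exp_pos _).le)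
    (tendsto_neg_factorial_mul_sum_mul_exp_neg n)
  simpa [upperGamma] using h

theorem lowerGamma_mul_div_rpow {c y : ℝ} (hc : 0 < c) (hy : 0 ≤ y) (s : ℝ) :
    lowerGamma s (c * y) / c ^ s = ∫ z in (0:ℝ)..y, z ^ (s - 1) * Real.exp (-(c * z)) := by
  have h := intervalIntegral.integral_comp_mul_left (a := 0) (b := y)
    (fun t : ℝ => t ^ (s - 1) * Real.exp (-t)) hc.ne'
  have h' : ∫ z in (0:ℝ)..y, (c * z) ^ (s - 1) * Real.exp (-(c * z))
      = c ^ (s - 1) * ∫ z in (0:ℝ)..y, z ^ (s - 1) * Real.exp (-(c * z)) := by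
    rw [← intervalIntegral.integral_const_mul]
    refine intervalIntegral.integral_congr fun z hz => ?_
    rw [uIcc_of_le hy] at hz
    simp only [Real.mul_rpow hc.le hz.1, mul_assoc]
  rw [h', mul_zero, smul_eq_mul] at h
  have hpow : c ^ s = c ^ (s - 1) * c := by
    rw [← Real.rpow_add_one hc.ne', sub_add_cancel]
  have hne : c ^ (s - 1) ≠ 0 := (Real.rpow_pos_of_pos hc _).ne'
  rw [hpow, lowerGamma, div_eq_iff (mul_ne_zero hne hc.ne')]
  have h2 := congrArg (c * ·) h
  simp only [mul_inv_cancel_left₀ hc.ne'] at h2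
  rw [← h2]
  ring

theorem intervalIntegrable_rpow_mul_exp_neg_mul {s : ℝ} (hs : 0 < s) (c x y : ℝ) :
    IntervalIntegrable (fun z : ℝ => z ^ (s - 1) * Real.exp (-(c * z))) volume x y :=
  (intervalIntegral.intervalIntegrable_rpow' (by linarith)).mul_continuousOn (by fun_prop)

theorem integral_pow_exp_mul_upperGamma
    (M : ℕ) (hM : 0 < M) (K : ℝ) (hK : 0 < K) (a b : ℝ) (ha : 0 < a) (hb : 0 < b)
    (y : ℝ) (hy : 0 ≤ y) :
    ∫ z in (0:ℝ)..y, z ^ (K - 1) * Real.exp (-(a * z)) * upperGamma (M : ℝ) (b * z)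
      = (Nat.factorial (M - 1) : ℝ)
          * ∑ l ∈ Finset.range M,
              (b ^ l / (Nat.factorial l : ℝ))
                * lowerGamma (K + l) ((a + b) * y) / (a + b) ^ (K + (l : ℝ)) := by
  obtain ⟨n, rfl⟩ : ∃ n, M = n + 1 := ⟨M - 1, by omega⟩
  have hab : 0 < a + b := add_pos ha hb
  have hsum : ∫ z in (0:ℝ)..y,
        z ^ (K - 1) * Real.exp (-(a * z)) * upperGamma ((n + 1 : ℕ) : ℝ) (b * z)
      = ∫ z in (0:ℝ)..y, ∑ l ∈ Finset.range (n + 1),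
          (n.factorial : ℝ) * (b ^ l / (l.factorial : ℝ))
            * (z ^ (K + l - 1) * Real.exp (-((a + b) * z))) := by
    refine intervalIntegral.integral_congr_ae (Eventually.of_forall fun z hz => ?_)
    rw [uIoc_of_le hy] at hz
    have hexp : Real.exp (-((a + b) * z)) = Real.exp (-(a * z)) * Real.exp (-(b * z)) := by
      rw [← Real.exp_add]
      ring_nf
    rw [Nat.cast_add_one, upperGamma_natCast_add_one n (mul_pos hb hz.1).le,
      Finset.mul_sum, Finset.sum_mul, Finset.mul_sum]
    refine Finset.sum_congr rfl fun l _ => ?_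
    rw [add_sub_right_comm, Real.rpow_add_natCast hz.1.ne', hexp, mul_pow]
    ring
  rw [hsum, intervalIntegral.integral_finsetSum fun l _ =>
    (intervalIntegrable_rpow_mul_exp_neg_mul (by positivity) _ _ _).const_mul _,
    Nat.add_sub_cancel, Finset.mul_sum]
  refine Finset.sum_congr rfl fun l _ => ?_
  rw [intervalIntegral.integral_const_mul, ← lowerGamma_mul_div_rpow hab hy]
  ring
end

section
/- Let A > 0 be real, let B and P be positive integers, let c, q, r > 0, and let γth ≥ 0. Then ∫_{γth}^∞ y^{A−1} e^{−c y} · (γ(B, q y)/(B−1)!) · (γ(P, r y)/(P−1)!) dy = I1 + I2 + I3 + I4, where I1 = Γ(A, c γth)/c^A; I2 = − Σ_{n=0}^{B−1} q^n Γ(A+n, (c+q) γth) / (n! (c+q)^{A+n}); I3 = − Σ_{p=0}^{P−1} r^p Γ(A+p, (c+r) γth) / (p! (c+r)^{A+p}); and I4 = Σ_{n=0}^{B−1} Σ_{p=0}^{P−1} q^n r^p Γ(A+n+p, (c+q+r) γth) / (n! p! (c+q+r)^{A+n+p}). -/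
open MeasureTheory Real Set Filter

/-- The derivative of the truncated exponential series times `exp (-x)` telescopes. -/
lemma hasDerivAt_neg_exp_neg_mul_sum (k : ℕ) (x : ℝ) :
    HasDerivAt (fun t : ℝ => -(exp (-t) * ∑ n ∈ Finset.range (k + 1), t ^ n / (n.factorial : ℝ)))
      (x ^ k * exp (-x) / (k.factorial : ℝ)) x := by
  induction k with
  | zero => simpa using ((hasDerivAt_id x).fun_neg.exp).fun_neg
  | succ k ih =>
    have h := ((hasDerivAt_id x).neg.exp).mul
      ((hasDerivAt_pow (k + 1) x).div_const ((k + 1).factorial : ℝ))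
    refine ((ih.sub h).congr_deriv ?_).congr_of_eventuallyEq (Eventually.of_forall fun t => ?_)
    · have hk : (k.factorial : ℝ) ≠ 0 := by positivity
      simp only [Nat.factorial_succ, id, Pi.neg_apply]
      push_cast
      field_simp
      simp
    · simp only [Finset.sum_range_succ _ (k + 1), Pi.sub_apply, Pi.mul_apply, Pi.neg_apply, id]
      ring

lemma lowerGamma_natCast_div_factorial {m : ℕ} (hm : 0 < m) (x : ℝ) :
    lowerGamma m x / ((m - 1).factorial : ℝ)
      = 1 - exp (-x) * ∑ n ∈ Finset.range m, x ^ n / (n.factorial : ℝ) := by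
  obtain ⟨k, rfl⟩ := Nat.exists_eq_add_one.mpr hm
  have hFTC := intervalIntegral.integral_eq_sub_of_hasDerivAt
    (fun t (_ : t ∈ uIcc 0 x) => hasDerivAt_neg_exp_neg_mul_sum k t)
    (Continuous.intervalIntegrable (by fun_prop) 0 x)
  rw [intervalIntegral.integral_div] at hFTC
  have h0 : ∑ n ∈ Finset.range (k + 1), (0 : ℝ) ^ n / (n.factorial : ℝ) = 1 := by
    simp [Finset.sum_range_succ']
  simp only [lowerGamma, Nat.cast_add, Nat.cast_one, add_sub_cancel_right, rpow_natCast,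
    Nat.add_sub_cancel]
  rw [hFTC, h0]
  simp
  ring

lemma integrableOn_rpow_mul_exp_neg_mul_Ioi {s b g : ℝ} (hs : 0 < s) (hb : 0 < b) (hg : 0 ≤ g) :
    IntegrableOn (fun y : ℝ => y ^ (s - 1) * exp (-(b * y))) (Ioi g) := by
  have h := integrableOn_rpow_mul_exp_neg_mul_rpow (s := s - 1) (p := 1) (by linarith) zero_lt_one hb
  simp only [rpow_one, neg_mul] at h
  exact h.mono_set (Ioi_subset_Ioi hg)

lemma integral_rpow_mul_exp_neg_mul_Ioi_eq_upperGamma {b g : ℝ} (s : ℝ) (hb : 0 < b)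
    (hg : 0 ≤ g) :
    ∫ y in Ioi g, y ^ (s - 1) * exp (-(b * y)) = upperGamma s (b * g) / b ^ s := by
  have h := integral_comp_mul_left_Ioi (fun t : ℝ => t ^ (s - 1) * exp (-t)) g hb
  have hcongr : ∫ y in Ioi g, (b * y) ^ (s - 1) * exp (-(b * y))
      = b ^ (s - 1) * ∫ y in Ioi g, y ^ (s - 1) * exp (-(b * y)) := by
    rw [← integral_const_mul]
    refine setIntegral_congr_fun measurableSet_Ioi fun y hy => ?_
    simp only [mul_rpow hb.le (hg.trans (mem_Ioi.mp hy).le), mul_assoc]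
  rw [hcongr, smul_eq_mul, rpow_sub_one hb.ne'] at h
  have hbs := (rpow_pos_of_pos hb s).ne'
  rw [eq_div_iff hbs, upperGamma]
  field_simp at h
  linarith

theorem integral_pow_exp_mul_two_lowerGamma
    (A : ℝ) (hA : 0 < A) (B Pn : ℕ) (hB : 0 < B) (hP : 0 < Pn)
    (c q r : ℝ) (hc : 0 < c) (hq : 0 < q) (hr : 0 < r)
    (γth : ℝ) (hγth : 0 ≤ γth) :
    ∫ y in Set.Ioi γth,
        y ^ (A - 1) * Real.exp (-(c * y))
          * (lowerGamma (B : ℝ) (q * y) / (Nat.factorial (B - 1) : ℝ))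
          * (lowerGamma (Pn : ℝ) (r * y) / (Nat.factorial (Pn - 1) : ℝ))
      = upperGamma A (c * γth) / c ^ A
        + (- ∑ n ∈ Finset.range B,
              q ^ n * upperGamma (A + n) ((c + q) * γth)
                / ((Nat.factorial n : ℝ) * (c + q) ^ (A + (n : ℝ))))
        + (- ∑ p ∈ Finset.range Pn,
              r ^ p * upperGamma (A + p) ((c + r) * γth)
                / ((Nat.factorial p : ℝ) * (c + r) ^ (A + (p : ℝ))))
        + ∑ n ∈ Finset.range B, ∑ p ∈ Finset.range Pn,
              q ^ n * r ^ p * upperGamma (A + n + p) ((c + q + r) * γth)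
                / ((Nat.factorial n : ℝ) * (Nat.factorial p : ℝ)
                    * (c + q + r) ^ (A + (n : ℝ) + (p : ℝ))) := by
  have hterm : ∀ {s b : ℝ}, 0 < s → 0 < b →
      IntegrableOn (fun y : ℝ => y ^ (s - 1) * exp (-(b * y))) (Ioi γth) :=
    fun hs hb => integrableOn_rpow_mul_exp_neg_mul_Ioi hs hb hγth
  have hexpand : ∀ y ∈ Ioi γth,
      y ^ (A - 1) * exp (-(c * y))
          * (lowerGamma (B : ℝ) (q * y) / (Nat.factorial (B - 1) : ℝ))
          * (lowerGamma (Pn : ℝ) (r * y) / (Nat.factorial (Pn - 1) : ℝ))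
        = y ^ (A - 1) * exp (-(c * y))
          - (∑ n ∈ Finset.range B, q ^ n / (n.factorial : ℝ)
              * (y ^ (A + n - 1) * exp (-((c + q) * y))))
          - (∑ p ∈ Finset.range Pn, r ^ p / (p.factorial : ℝ)
              * (y ^ (A + p - 1) * exp (-((c + r) * y))))
          + ∑ n ∈ Finset.range B, ∑ p ∈ Finset.range Pn,
              q ^ n * r ^ p / ((n.factorial : ℝ) * (p.factorial : ℝ))
                * (y ^ (A + n + p - 1) * exp (-((c + q + r) * y))) := by
    intro y hy
    have hy0 : 0 < y := hγth.trans_lt hy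
    have hpow : ∀ (s : ℝ) (n : ℕ), y ^ (s + n - 1) = y ^ (s - 1) * y ^ n := fun s n => by
      rw [← rpow_natCast, ← rpow_add hy0]
      ring_nf
    have hexp : ∀ a b : ℝ, exp (-((a + b) * y)) = exp (-(a * y)) * exp (-(b * y)) :=
      fun a b => by
        rw [← exp_add]
        ring_nf
    rw [lowerGamma_natCast_div_factorial hB, lowerGamma_natCast_div_factorial hP]
    have hq_sum : ∑ n ∈ Finset.range B, q ^ n / (n.factorial : ℝ)
          * (y ^ (A + n - 1) * exp (-((c + q) * y)))
        = y ^ (A - 1) * exp (-(c * y)) * (exp (-(q * y))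
          * ∑ n ∈ Finset.range B, (q * y) ^ n / (n.factorial : ℝ)) := by
      simp only [Finset.mul_sum, hpow, hexp, mul_pow]
      exact Finset.sum_congr rfl fun n _ => by ring
    have hr_sum : ∑ p ∈ Finset.range Pn, r ^ p / (p.factorial : ℝ)
          * (y ^ (A + p - 1) * exp (-((c + r) * y)))
        = y ^ (A - 1) * exp (-(c * y)) * (exp (-(r * y))
          * ∑ p ∈ Finset.range Pn, (r * y) ^ p / (p.factorial : ℝ)) := by
      simp only [Finset.mul_sum, hpow, hexp, mul_pow]
      exact Finset.sum_congr rfl fun p _ => by ring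
    have hqr_sum : ∑ n ∈ Finset.range B, ∑ p ∈ Finset.range Pn,
          q ^ n * r ^ p / ((n.factorial : ℝ) * (p.factorial : ℝ))
            * (y ^ (A + n + p - 1) * exp (-((c + q + r) * y)))
        = y ^ (A - 1) * exp (-(c * y)) * (exp (-(q * y)) * exp (-(r * y))
          * ((∑ n ∈ Finset.range B, (q * y) ^ n / (n.factorial : ℝ))
            * ∑ p ∈ Finset.range Pn, (r * y) ^ p / (p.factorial : ℝ))) := by
      simp only [Finset.sum_mul_sum]
      simp only [Finset.mul_sum, hpow, hexp, mul_pow]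
      refine Finset.sum_congr rfl fun n _ => Finset.sum_congr rfl fun p _ => ?_
      field_simp
    rw [hq_sum, hr_sum, hqr_sum]
    ring
  have hq_int : ∀ n ∈ Finset.range B, IntegrableOn (fun y : ℝ => q ^ n / (n.factorial : ℝ)
      * (y ^ (A + n - 1) * exp (-((c + q) * y)))) (Ioi γth) :=
    fun n _ => (hterm (by positivity) (by positivity)).const_mul _
  have hr_int : ∀ p ∈ Finset.range Pn, IntegrableOn (fun y : ℝ => r ^ p / (p.factorial : ℝ)
      * (y ^ (A + p - 1) * exp (-((c + r) * y)))) (Ioi γth) :=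
    fun p _ => (hterm (by positivity) (by positivity)).const_mul _
  have hqr_int : ∀ n ∈ Finset.range B, ∀ p ∈ Finset.range Pn, IntegrableOn (fun y : ℝ =>
      q ^ n * r ^ p / ((n.factorial : ℝ) * (p.factorial : ℝ))
        * (y ^ (A + n + p - 1) * exp (-((c + q + r) * y)))) (Ioi γth) :=
    fun n _ p _ => (hterm (by positivity) (by positivity)).const_mul _
  have hA_int := hterm hA hc
  have hq_sum_int := integrable_finsetSum _ hq_int
  have hr_sum_int := integrable_finsetSum _ hr_int
  have hqr_sum_int := integrable_finsetSum _ fun n hn => integrable_finsetSum _ (hqr_int n hn)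
  rw [setIntegral_congr_fun measurableSet_Ioi hexpand,
    integral_add ((hA_int.sub' hq_sum_int).sub' hr_sum_int) hqr_sum_int,
    integral_sub (hA_int.sub' hq_sum_int) hr_sum_int, integral_sub hA_int hq_sum_int,
    integral_finsetSum _ hq_int, integral_finsetSum _ hr_int,
    integral_finsetSum _ fun n hn => integrable_finsetSum _ (hqr_int n hn),
    Finset.sum_congr rfl fun n hn => integral_finsetSum _ (hqr_int n hn)]
  simp only [integral_const_mul,
    integral_rpow_mul_exp_neg_mul_Ioi_eq_upperGamma _ hc hγth,
    integral_rpow_mul_exp_neg_mul_Ioi_eq_upperGamma _ (add_pos hc hq) hγth,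
    integral_rpow_mul_exp_neg_mul_Ioi_eq_upperGamma _ (add_pos hc hr) hγth,
    integral_rpow_mul_exp_neg_mul_Ioi_eq_upperGamma _ (add_pos (add_pos hc hq) hr) hγth,
    div_mul_div_comm]
  ring
end

section
/- Let α, μ > 0 and p, c > 0 be reals, and let X and W be independent real random variables where X has the Gamma distribution with shape α and rate p, and W has the Gamma distribution with shape μ and rate c. Then P(X > W) = (p^α c^μ Γ(α+μ)) / (Γ(α) Γ(μ+1) (c+p)^{α+μ}) · Σ_{n=0}^∞ ((α+μ)_n / (μ+1)_n) · (c/(c+p))^n, where (x)_n = x(x+1)···(x+n−1) denotes the rising factorial (Pochhammer symbol), the series on the right converging since 0 < c/(c+p) < 1. (The series equals the Gauss hypergeometric value ₂F₁(1, α+μ; μ+1; c/(c+p)).) -/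
open MeasureTheory ProbabilityTheory Real Set Filter

lemma ascPochhammer_eval_eq_Gamma_div {x : ℝ} (hx : 0 < x) (n : ℕ) :
    (ascPochhammer ℝ n).eval x = Real.Gamma (x + n) / Real.Gamma x := by
  induction n with
  | zero => simp [(Real.Gamma_pos_of_pos hx).ne']
  | succ n ih =>
    rw [ascPochhammer_succ_eval, ih, Nat.cast_succ, ← add_assoc,
      Real.Gamma_add_one (by positivity)]
    ring

lemma integral_rpow_mul_sub_pow {a x : ℝ} (ha : 0 < a) (hx : 0 < x) (n : ℕ) :
    ∫ t in (0 : ℝ)..x, t ^ (a - 1) * (x - t) ^ n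
      = x ^ (a + n) * (Real.Gamma a * n.factorial / Real.Gamma (a + n + 1)) := by
  have h := Complex.betaIntegral_scaled (a : ℂ) (n + 1 : ℂ) hx
  have hb := Complex.Gamma_mul_Gamma_eq_betaIntegral (s := (a : ℂ)) (t := (n + 1 : ℂ))
    (by simpa using ha) (by simp; positivity)
  have hG : Real.Gamma (a + n + 1) ≠ 0 := (Real.Gamma_pos_of_pos (by positivity)).ne'
  have hb' : Complex.betaIntegral a (n + 1)
      = ((Real.Gamma a * n.factorial / Real.Gamma (a + n + 1) : ℝ) : ℂ) := by
    rw [Complex.Gamma_nat_eq_factorial, Complex.Gamma_ofReal, ← add_assoc] at hb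
    have : Complex.Gamma (a + n + 1) = (Real.Gamma (a + n + 1) : ℂ) := by
      rw [← Complex.Gamma_ofReal]; push_cast; rfl
    rw [this] at hb
    push_cast
    rw [hb, mul_div_cancel_left₀ _ (by exact_mod_cast hG)]
  rw [hb'] at h
  apply Complex.ofReal_injective
  rw [← intervalIntegral.integral_ofReal]
  push_cast
  rw [Complex.ofReal_cpow hx.le]
  push_cast at h ⊢
  rw [show (a + (n + 1) - 1 : ℂ) = a + n by ring] at h
  rw [← h]
  refine intervalIntegral.integral_congr fun t ht ↦ ?_
  rw [uIcc_of_le hx.le] at ht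
  simp [Complex.ofReal_cpow ht.1]

lemma lintegral_Ioo_rpow_mul_sub_pow {a x : ℝ} (ha : 0 < a) (hx : 0 < x) (n : ℕ) :
    ∫⁻ t in Ioo 0 x, ENNReal.ofReal (t ^ (a - 1) * (x - t) ^ n)
      = ENNReal.ofReal (x ^ (a + n) * (Real.Gamma a * n.factorial / Real.Gamma (a + n + 1))) := by
  have hint : IntervalIntegrable (fun t : ℝ ↦ t ^ (a - 1) * (x - t) ^ n) volume 0 x :=
    (intervalIntegral.intervalIntegrable_rpow' (by linarith)).mul_continuousOn (by fun_prop)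
  rw [← integral_rpow_mul_sub_pow ha hx, intervalIntegral.integral_of_le hx.le,
    integral_Ioc_eq_integral_Ioo, ofReal_integral_eq_lintegral_ofReal]
  · exact ((intervalIntegrable_iff_integrableOn_Ioc_of_le hx.le).1 hint).mono_set Ioo_subset_Ioc_self
  · filter_upwards [ae_restrict_mem measurableSet_Ioo] with t ht
    exact mul_nonneg (rpow_nonneg ht.1.le _) (pow_nonneg (sub_nonneg.2 ht.2.le) _)

/-- The distribution function of a Gamma law as a series of Gamma densities of higher shapes. -/
lemma gammaMeasure_Iio_eq_tsum {a r : ℝ} (ha : 0 < a) (hr : 0 < r) (x : ℝ) :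
    gammaMeasure a r (Iio x) = ∑' n : ℕ, ENNReal.ofReal r⁻¹ * gammaPDF (a + n + 1) r x := by
  rw [gammaMeasure, withDensity_apply _ measurableSet_Iio]
  rcases le_or_gt x 0 with hx | hx
  · rw [lintegral_gammaPDF_of_nonpos hx]
    rcases hx.lt_or_eq with hx | rfl
    · simp [gammaPDF_of_neg hx]
    · have (n : ℕ) : a + n ≠ 0 := by positivity
      simp [gammaPDF_of_nonneg le_rfl, Real.zero_rpow (this _)]
  have hsplit : ∫⁻ t in Iio x, gammaPDF a r t = ∫⁻ t in Ioo 0 x, gammaPDF a r t := by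
    rw [← Iio_union_Ico_eq_Iio hx.le, lintegral_union measurableSet_Ico
      (by exact (Iio_disjoint_Ici le_rfl).mono_right Ico_subset_Ici_self),
      lintegral_gammaPDF_of_nonpos le_rfl, zero_add, setLIntegral_congr Ioo_ae_eq_Ico]
  have hexp (t : ℝ) (ht : t ∈ Ioo 0 x) : gammaPDF a r t = ∑' n : ℕ,
      ENNReal.ofReal (r ^ a / Real.Gamma a * exp (-(r * x)) * (r ^ n / n.factorial))
        * ENNReal.ofReal (t ^ (a - 1) * (x - t) ^ n) := by
    have hs := (NormedSpace.expSeries_div_hasSum_exp (𝔸 := ℝ) (r * (x - t))).mul_left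
      (r ^ a / Real.Gamma a * t ^ (a - 1) * exp (-(r * x)))
    rw [← Real.exp_eq_exp_ℝ] at hs
    have hG := Real.Gamma_pos_of_pos ha
    have hxt := sub_pos.2 ht.2
    have ht0 := ht.1
    rw [gammaPDF_of_nonneg ht.1.le,
      show r ^ a / Real.Gamma a * t ^ (a - 1) * exp (-(r * t))
        = r ^ a / Real.Gamma a * t ^ (a - 1) * exp (-(r * x)) * exp (r * (x - t)) by
          rw [mul_assoc _ (exp _), ← Real.exp_add]; ring_nf,
      ← hs.tsum_eq, ENNReal.ofReal_tsum_of_nonneg (fun n ↦ by positivity) hs.summable]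
    refine tsum_congr fun n ↦ ?_
    rw [← ENNReal.ofReal_mul (by positivity), mul_pow]
    congr 1
    ring
  rw [hsplit, setLIntegral_congr_fun measurableSet_Ioo hexp, lintegral_tsum (by fun_prop)]
  refine tsum_congr fun n ↦ ?_
  have hG := Real.Gamma_pos_of_pos ha
  rw [lintegral_const_mul _ (by fun_prop), lintegral_Ioo_rpow_mul_sub_pow ha hx,
    gammaPDF_of_nonneg hx.le, ← ENNReal.ofReal_mul (by positivity),
    ← ENNReal.ofReal_mul (by positivity)]
  congr 1
  rw [add_sub_cancel_right, rpow_add_one hr.ne' (a + n), rpow_add_natCast hr.ne']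
  field_simp

lemma lintegral_gammaPDF_gammaMeasure {a b r s : ℝ} (hab : 1 < a + b) (ha : 0 < a) (hb : 0 < b)
    (hr : 0 < r) (hs : 0 < s) :
    ∫⁻ x, gammaPDF a r x ∂(gammaMeasure b s)
      = ENNReal.ofReal (r ^ a * s ^ b * Real.Gamma (a + b - 1)
          / (Real.Gamma a * Real.Gamma b * (r + s) ^ (a + b - 1))) := by
  have hGa := Real.Gamma_pos_of_pos ha
  have hGb := Real.Gamma_pos_of_pos hb
  have hGab := Real.Gamma_pos_of_pos (sub_pos.2 hab)
  have hm (a r : ℝ) : Measurable (gammaPDF a r) := (measurable_gammaPDFReal a r).ennreal_ofReal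
  rw [gammaMeasure, lintegral_withDensity_eq_lintegral_mul _ (hm b s) (hm a r),
    ← mul_one (ENNReal.ofReal _), ← lintegral_gammaPDF_eq_one (sub_pos.2 hab) (add_pos hr hs), ← lintegral_const_mul _ (hm _ _)]
  refine lintegral_congr_ae ?_
  filter_upwards [compl_mem_ae_iff.2 (measure_singleton (0 : ℝ))] with x hx
  rcases lt_or_gt_of_ne hx with hx | hx
  · simp [gammaPDF_of_neg hx]
  · rw [Pi.mul_apply, gammaPDF_of_nonneg hx.le, gammaPDF_of_nonneg hx.le, gammaPDF_of_nonneg hx.le,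
      ← ENNReal.ofReal_mul (by positivity), ← ENNReal.ofReal_mul (by positivity)]
    congr 1
    rw [show a + b - 1 - 1 = (a - 1) + (b - 1) by ring, rpow_add hx,
      show -((r + s) * x) = -(r * x) + -(s * x) by ring, Real.exp_add]
    field_simp

lemma measure_lt_eq_lintegral {Ω : Type*} [MeasurableSpace Ω] {P : Measure Ω}
    [IsProbabilityMeasure P] {X W : Ω → ℝ} (hX : Measurable X) (hW : Measurable W)
    (hindep : IndepFun X W P) :
    P {ω | W ω < X ω} = ∫⁻ x, P.map W (Iio x) ∂(P.map X) := by
  have := Measure.isProbabilityMeasure_map (μ := P) hX.aemeasurable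
  have := Measure.isProbabilityMeasure_map (μ := P) hW.aemeasurable
  have hS : MeasurableSet {z : ℝ × ℝ | z.2 < z.1} := measurableSet_lt measurable_snd measurable_fst
  have h := Measure.map_apply (μ := P) (hX.prodMk hW) hS
  rw [(indepFun_iff_map_prod_eq_prod_map_map hX.aemeasurable hW.aemeasurable).1 hindep,
    Measure.prod_apply hS] at h
  exact h.symm

/-- Probability that one Gamma random variable exceeds an independent one, expressed via a
Gauss hypergeometric series: `X` has shape `α` and rate `p`, `W` has shape `μ` and rate `c`,
and `(x)_n` is the rising factorial (`ascPochhammer`). -/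
theorem prob_gamma_gt_gamma_eq_hypergeometric_series
    {Ωs : Type*} [MeasurableSpace Ωs] (P : Measure Ωs) [IsProbabilityMeasure P]
    (α μ p c : ℝ) (hα : 0 < α) (hμ : 0 < μ) (hp : 0 < p) (hc : 0 < c)
    (X W : Ωs → ℝ) (hX : Measurable X) (hW : Measurable W)
    (hindep : IndepFun X W P)
    (hXdist : Measure.map X P = gammaMeasure α p)
    (hWdist : Measure.map W P = gammaMeasure μ c) :
    Summable (fun n : ℕ =>
        ((ascPochhammer ℝ n).eval (α + μ) / (ascPochhammer ℝ n).eval (μ + 1))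
          * (c / (c + p)) ^ n) ∧
    (P {ω | X ω > W ω}).toReal
      = (p ^ α * c ^ μ * Real.Gamma (α + μ))
          / (Real.Gamma α * Real.Gamma (μ + 1) * (c + p) ^ (α + μ))
        * ∑' n : ℕ,
            ((ascPochhammer ℝ n).eval (α + μ) / (ascPochhammer ℝ n).eval (μ + 1))
              * (c / (c + p)) ^ n := by
  set f : ℕ → ℝ := fun n ↦
    ((ascPochhammer ℝ n).eval (α + μ) / (ascPochhammer ℝ n).eval (μ + 1)) * (c / (c + p)) ^ n
  set K : ℝ := (p ^ α * c ^ μ * Real.Gamma (α + μ))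
    / (Real.Gamma α * Real.Gamma (μ + 1) * (c + p) ^ (α + μ)) with hK
  have hG₁ := Real.Gamma_pos_of_pos hα
  have hG₂ := Real.Gamma_pos_of_pos (add_pos hα hμ)
  have hG₃ := Real.Gamma_pos_of_pos (add_pos hμ one_pos)
  have hKpos : 0 < K := by positivity
  have hf (n : ℕ) : 0 ≤ f n :=
    mul_nonneg (div_nonneg (ascPochhammer_pos n _ (by positivity)).le
      (ascPochhammer_pos n _ (by positivity)).le) (by positivity)
  have hterm (n : ℕ) : ENNReal.ofReal c⁻¹ * ∫⁻ x, gammaPDF (μ + n + 1) c x ∂(gammaMeasure α p)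
      = ENNReal.ofReal (K * f n) := by
    have hn : (0 : ℝ) ≤ n := n.cast_nonneg
    have hG₄ := Real.Gamma_pos_of_pos (show 0 < μ + n + 1 by positivity)
    rw [lintegral_gammaPDF_gammaMeasure (by linarith) (by linarith) hα hc hp,
      ← ENNReal.ofReal_mul (by positivity)]
    congr 1
    simp only [f, hK]
    rw [ascPochhammer_eval_eq_Gamma_div (by positivity),
      ascPochhammer_eval_eq_Gamma_div (by positivity),
      show μ + n + 1 + α - 1 = α + μ + n by ring, show μ + 1 + (n : ℝ) = μ + n + 1 by ring,
      rpow_add_one hc.ne', rpow_add_natCast hc.ne', rpow_add_natCast (by positivity), div_pow]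
    field_simp
  have hP : P {ω | X ω > W ω} = ∑' n, ENNReal.ofReal (K * f n) := by
    rw [← tsum_congr hterm]
    simp_rw [gt_iff_lt]
    rw [measure_lt_eq_lintegral hX hW hindep, hXdist, hWdist]
    simp_rw [gammaMeasure_Iio_eq_tsum hμ hc]
    have hm (a r : ℝ) : Measurable (gammaPDF a r) := (measurable_gammaPDFReal a r).ennreal_ofReal
    rw [lintegral_tsum fun n ↦ ((hm _ _).const_mul _).aemeasurable]
    exact tsum_congr fun n ↦ lintegral_const_mul _ (hm _ _)
  have hnonneg (n : ℕ) : 0 ≤ K * f n := mul_nonneg hKpos.le (hf n)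
  have hsum : Summable fun n ↦ K * f n :=
    (ENNReal.summable_toReal (hP ▸ measure_ne_top P _)).congr
      fun n ↦ ENNReal.toReal_ofReal (hnonneg n)
  refine ⟨(summable_mul_left_iff hKpos.ne').1 hsum, ?_⟩
  rw [hP, ← ENNReal.ofReal_tsum_of_nonneg hnonneg hsum,
    ENNReal.toReal_ofReal (tsum_nonneg hnonneg), tsum_mul_left]
end

section
/- Let N1, N2, N3, N4 > 0 be reals, let λ2, λ4 > 0 be fixed eavesdropper rates, let γth ≥ 0, and let m_SR, m_RD > 0. For each hop XZ ∈ {SR, RD}, let ρ_XZ ∈ [0,1], Ω_XZ > 0, σε²_XZ, σw²_XZ ≥ 0 with ρ_XZ² σε²_XZ + (1−ρ_XZ²) σw²_XZ > 0, and define Υ_XZ(δ) = ρ_XZ² δ / ( (δ/Ω_XZ)(ρ_XZ² σε²_XZ + (1−ρ_XZ²) σw²_XZ) + 1 ) and the ceiling Ξ_XZ = ρ_XZ² Ω_XZ / (ρ_XZ² σε²_XZ + (1−ρ_XZ²) σw²_XZ). For δ > 0, let P_int(δ) = 1 − P(X1 > γth and X1 > X2 and X1 > X4 and X3 > X4), where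 X1, X2, X3, X4 are independent with Gamma distributions of shapes N1, N2, N3, N4 and rates m_SR/Υ_SR(δ), λ2, m_RD/Υ_RD(δ), λ4, respectively. Then P_int(δ) converges as δ → +∞ to the saturation floor P_int^∞ = 1 − P(Y1 > γth and Y1 > Y2 and Y1 > Y4 and Y3 > Y4), where Y1, Y2, Y3, Y4 are independent with Gamma distributions of shapes N1, N2, N3, N4 and rates m_SR/Ξ_SR, λ2, m_RD/Ξ_RD, λ4, respectively; in particular P_int(δ) does not tend to 0, so the secrecy diversity order is zero. -/
open MeasureTheory ProbabilityTheory Real Set Filter Topology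

/-- Tonelli's theorem for a product of functions of the separate coordinates. -/
theorem lintegral_pi_prod {n : ℕ} {E : Type*} [MeasurableSpace E]
    (μ : Fin n → Measure E) [∀ i, SigmaFinite (μ i)] (f : Fin n → E → ENNReal)
    (hf : ∀ i, Measurable (f i)) :
    ∫⁻ x, ∏ i, f i (x i) ∂(Measure.pi μ) = ∏ i, ∫⁻ y, f i y ∂(μ i) := by
  induction n with
  | zero => simp
  | succ n ih =>
    have hg : Measurable fun x : Fin n → E => ∏ i, f i.succ (x i) :=
      Finset.measurable_prod _ fun i _ => (hf _).comp (measurable_pi_apply i)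
    rw [← ((measurePreserving_piFinSuccAbove μ 0).symm).lintegral_comp_emb
      (MeasurableEquiv.measurableEmbedding _)]
    simp_rw [MeasurableEquiv.piFinSuccAbove_symm_apply, Fin.insertNthEquiv,
      Fin.prod_univ_succ, Fin.insertNth_zero, Equiv.coe_fn_mk, Fin.cons_succ, Fin.zero_succAbove,
      cast_eq, Fin.cons_zero]
    rw [lintegral_prod_mul (hf 0).aemeasurable hg.aemeasurable,
      ih (fun i => μ i.succ) (fun i => f i.succ) fun i => hf _]

theorem pi_withDensity {n : ℕ} {E : Type*} [MeasurableSpace E]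
    (μ : Fin n → Measure E) [∀ i, SigmaFinite (μ i)] (f : Fin n → E → ENNReal)
    (hf : ∀ i, Measurable (f i)) [∀ i, SigmaFinite ((μ i).withDensity (f i))] :
    Measure.pi (fun i => (μ i).withDensity (f i)) =
      (Measure.pi μ).withDensity fun x => ∏ i, f i (x i) := by
  refine Measure.pi_eq fun s hs => ?_
  rw [withDensity_apply _ (MeasurableSet.univ_pi hs), Measure.restrict_pi_pi,
    lintegral_pi_prod _ _ hf]
  exact Finset.prod_congr rfl fun i _ => (withDensity_apply _ (hs i)).symm

@[fun_prop]
theorem measurable_gammaPDF (a r : ℝ) : Measurable (gammaPDF a r) :=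
  (measurable_gammaPDFReal a r).ennreal_ofReal

instance sigmaFinite_gammaMeasure (a r : ℝ) : SigmaFinite (gammaMeasure a r) :=
  SigmaFinite.withDensity_ofReal _

theorem gammaMeasure_rate_zero {a : ℝ} (ha : 0 < a) : gammaMeasure a 0 = 0 := by
  have h : gammaPDF a 0 = 0 := by
    ext x
    simp [gammaPDF, gammaPDFReal, Real.zero_rpow ha.ne']
  rw [gammaMeasure, h, withDensity_zero]

theorem lintegral_gammaPDF_ne_top {a r : ℝ} (ha : 0 < a) (hr : 0 ≤ r) :
    ∫⁻ x, gammaPDF a r x ≠ ⊤ := by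
  rcases hr.eq_or_lt with rfl | hr
  · rw [← setLIntegral_univ, ← withDensity_apply _ MeasurableSet.univ, ← gammaMeasure,
      gammaMeasure_rate_zero ha]
    simp
  · simp [lintegral_gammaPDF_eq_one ha hr]

theorem gammaPDF_le_of_rate_le {a r s : ℝ} (ha : 0 < a) (hr : 0 ≤ r) (hrs : r ≤ s)
    (hsr : s ≤ 2 * r) (x : ℝ) :
    gammaPDF a s x ≤ ENNReal.ofReal (2 ^ a) * gammaPDF a r x := by
  rw [gammaPDF, gammaPDF, ← ENNReal.ofReal_mul (by positivity)]
  refine ENNReal.ofReal_le_ofReal ?_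
  unfold gammaPDFReal
  split_ifs with hx
  · have hΓ := Gamma_pos_of_pos ha
    have hpow : s ^ a ≤ 2 ^ a * r ^ a := by
      rw [← Real.mul_rpow (by norm_num) hr]
      exact Real.rpow_le_rpow (hr.trans hrs) hsr ha.le
    calc s ^ a / Gamma a * x ^ (a - 1) * rexp (-(s * x))
        ≤ (2 ^ a * r ^ a) / Gamma a * x ^ (a - 1) * rexp (-(r * x)) := by gcongr
      _ = _ := by ring
  · simp

theorem continuous_gammaPDF_rate {a : ℝ} (ha : 0 < a) (x : ℝ) :
    Continuous fun r => gammaPDF a r x := by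
  unfold gammaPDF gammaPDFReal
  refine ENNReal.continuous_ofReal.comp ?_
  split_ifs
  · have := Real.continuous_rpow_const ha.le
    fun_prop
  · fun_prop

theorem gammaMeasure_Ioo_pos {a r u v : ℝ} (ha : 0 < a) (hr : 0 < r) (hu : 0 ≤ u)
    (huv : u < v) : 0 < gammaMeasure a r (Ioo u v) := by
  rw [pos_iff_ne_zero, gammaMeasure, Ne, withDensity_apply_eq_zero (measurable_gammaPDF a r)]
  have h : {x | gammaPDF a r x ≠ 0} ∩ Ioo u v = Ioo u v :=
    inter_eq_right.2 fun x hx =>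
      (ENNReal.ofReal_pos.2 (gammaPDFReal_pos ha hr (hu.trans_lt hx.1))).ne'
  simp [h, huv]

theorem pi_gammaMeasure_apply {n : ℕ} (a r : Fin n → ℝ) {S : Set (Fin n → ℝ)}
    (hS : MeasurableSet S) :
    Measure.pi (fun i => gammaMeasure (a i) (r i)) S =
      ∫⁻ x in S, ∏ i, gammaPDF (a i) (r i) (x i) := by
  have : ∀ i, SigmaFinite ((volume : Measure ℝ).withDensity (gammaPDF (a i) (r i))) :=
    fun i => sigmaFinite_gammaMeasure (a i) (r i)
  simp_rw [gammaMeasure]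
  rw [pi_withDensity _ _ fun i => measurable_gammaPDF (a i) (r i), withDensity_apply _ hS,
    volume_pi]

/-- Products of gamma laws depend continuously on the rates, setwise, along rates approaching
their limits from above within a factor of two.  The limit rates may be `0`. -/
theorem tendsto_pi_gammaMeasure_apply {n : ℕ} {ι : Type*} {l : Filter ι}
    [l.IsCountablyGenerated] {a r₀ : Fin n → ℝ} {r : ι → Fin n → ℝ} (ha : ∀ i, 0 < a i)
    (hr₀ : ∀ i, 0 ≤ r₀ i) (hr : ∀ i, Tendsto (fun t => r t i) l (𝓝 (r₀ i)))
    (hbd : ∀ᶠ t in l, ∀ i, r₀ i ≤ r t i ∧ r t i ≤ 2 * r₀ i) {S : Set (Fin n → ℝ)}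
    (hS : MeasurableSet S) :
    Tendsto (fun t => Measure.pi (fun i => gammaMeasure (a i) (r t i)) S) l
      (𝓝 (Measure.pi (fun i => gammaMeasure (a i) (r₀ i)) S)) := by
  simp_rw [pi_gammaMeasure_apply a _ hS]
  refine tendsto_lintegral_filter_of_dominated_convergence
    (fun x => ∏ i, (ENNReal.ofReal (2 ^ a i) * gammaPDF (a i) (r₀ i) (x i))) ?_ ?_ ?_ ?_
  · exact Eventually.of_forall fun t => Finset.measurable_prod _ fun i _ =>
      (measurable_gammaPDF _ _).comp (measurable_pi_apply i)
  · filter_upwards [hbd] with t ht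
    exact Eventually.of_forall fun x => Finset.prod_le_prod' fun i _ =>
      gammaPDF_le_of_rate_le (ha i) (hr₀ i) (ht i).1 (ht i).2 (x i)
  · refine ne_top_of_le_ne_top ?_ (setLIntegral_le_lintegral S _)
    rw [volume_pi, lintegral_pi_prod (fun _ => volume)
      (fun i y => ENNReal.ofReal (2 ^ a i) * gammaPDF (a i) (r₀ i) y)
      fun i => (measurable_gammaPDF _ _).const_mul _]
    refine ENNReal.prod_ne_top fun i _ => ?_
    rw [lintegral_const_mul _ (measurable_gammaPDF _ _)]
    exact ENNReal.mul_ne_top ENNReal.ofReal_ne_top (lintegral_gammaPDF_ne_top (ha i) (hr₀ i))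
  · exact Eventually.of_forall fun x => ENNReal.tendsto_finsetProd_of_ne_top _
      (fun i _ => ((continuous_gammaPDF_rate (ha i) (x i)).tendsto (r₀ i)).comp (hr i))
      fun i _ => ENNReal.ofReal_ne_top

/-- The effective rate of a mobile hop decreases to its ceiling value `m / Ξ`. -/
theorem effective_rate_asymptotics {m ρ Ω s : ℝ} (hm : 0 < m) (hΩ : 0 < Ω) (hs : 0 < s) :
    0 ≤ m / (ρ ^ 2 * Ω / s) ∧
    Tendsto (fun δ => m / (ρ ^ 2 * δ / (δ / Ω * s + 1))) atTop (𝓝 (m / (ρ ^ 2 * Ω / s))) ∧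
    ∀ᶠ δ in atTop, m / (ρ ^ 2 * Ω / s) ≤ m / (ρ ^ 2 * δ / (δ / Ω * s + 1)) ∧
      m / (ρ ^ 2 * δ / (δ / Ω * s + 1)) ≤ 2 * (m / (ρ ^ 2 * Ω / s)) := by
  have hlim : m / (ρ ^ 2 * Ω / s) = m / ρ ^ 2 * (s / Ω) := by
    rw [div_div_eq_mul_div, div_mul_div_comm]
  have hrate : ∀ δ : ℝ, 0 < δ →
      m / (ρ ^ 2 * δ / (δ / Ω * s + 1)) = m / ρ ^ 2 * (s / Ω + δ⁻¹) := by
    intro δ hδ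
    rw [div_div_eq_mul_div, mul_div_mul_comm]
    congr 1
    field_simp
  have hc : 0 ≤ m / ρ ^ 2 := by positivity
  have hq : 0 < s / Ω := by positivity
  refine ⟨by positivity, ?_, ?_⟩
  · have h : Tendsto (fun δ : ℝ => m / ρ ^ 2 * (s / Ω + δ⁻¹)) atTop
        (𝓝 (m / ρ ^ 2 * (s / Ω + 0))) :=
      (tendsto_inv_atTop_zero.const_add _).const_mul _
    rw [hlim]
    rw [add_zero] at h
    refine h.congr' ?_
    filter_upwards [eventually_gt_atTop 0] with δ hδ using (hrate δ hδ).symm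
  · filter_upwards [eventually_gt_atTop 0,
      tendsto_inv_atTop_zero.eventually (ge_mem_nhds hq)] with δ hδ hδ'
    rw [hrate δ hδ, hlim, mul_left_comm]
    have := inv_pos.2 hδ
    constructor <;> gcongr <;> linarith

/-- Under independent gamma laws, possibly degenerate of rate `0`, the event that coordinate
`i` exceeds coordinate `j` has mass less than one. -/
theorem pi_gammaMeasure_gt_lt_one {n : ℕ} {a r : Fin n → ℝ} (ha : ∀ i, 0 < a i)
    (hr : ∀ i, 0 ≤ r i) {i j : Fin n} (hij : i ≠ j) :
    Measure.pi (fun k => gammaMeasure (a k) (r k)) {x | x i > x j} < 1 := by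
  set μ := Measure.pi (fun k => gammaMeasure (a k) (r k)) with hμ
  by_cases h0 : ∃ k, r k = 0
  · obtain ⟨k, hk⟩ := h0
    have : μ univ = 0 := by
      rw [hμ, Measure.pi_univ]
      exact Finset.prod_eq_zero (Finset.mem_univ k) (by simp [hk, gammaMeasure_rate_zero (ha k)])
    exact (measure_mono_null (subset_univ _) this).trans_lt one_pos
  · push Not at h0
    have hr' : ∀ k, 0 < r k := fun k => (hr k).lt_of_ne' (h0 k)
    have : ∀ k, IsProbabilityMeasure (gammaMeasure (a k) (r k)) := fun k =>
      isProbabilityMeasure_gammaMeasure (ha k) (hr' k)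
    have hS : MeasurableSet {x : Fin n → ℝ | x i > x j} :=
      measurableSet_lt (measurable_pi_apply j) (measurable_pi_apply i)
    have hbox : 0 < μ (univ.pi fun k => if k = i then Ioo (0 : ℝ) 1 else Ioo 1 2) := by
      rw [hμ, Measure.pi_pi, pos_iff_ne_zero, Finset.prod_ne_zero_iff]
      intro k _
      split_ifs
      · exact (gammaMeasure_Ioo_pos (ha k) (hr' k) le_rfl one_pos).ne'
      · exact (gammaMeasure_Ioo_pos (ha k) (hr' k) zero_le_one one_lt_two).ne'
    refine prob_le_one.lt_of_ne fun h1 => ?_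
    have hc := (prob_compl_eq_zero_iff hS).2 h1
    refine hbox.ne' (measure_mono_null (fun x hx => ?_) hc)
    have hi := hx i (mem_univ i)
    have hj := hx j (mem_univ j)
    simp only [if_true, if_neg hij.symm, mem_Ioo] at hi hj
    simp only [mem_compl_iff, mem_ofPred_eq, not_lt, gt_iff_lt]
    linarith

/-- Scenario I (mobile nodes with imperfect CSI): the intercept probability converges, as the
nominal average SNR `δ → ∞`, to a strictly positive saturation floor obtained by replacing the
legitimate effective average SNRs by their ceiling values; in particular it does not tend to
`0`, i.e. the secrecy diversity order is zero.  Coordinates of the product measure: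
`x 0 = γ_SR`, `x 1 = γ_SE₁`, `x 2 = γ_RD`, `x 3 = γ_RE₂`. -/
theorem intercept_probability_saturation_floor
    (N1 N2 N3 N4 : ℝ) (hN1 : 0 < N1) (hN2 : 0 < N2) (hN3 : 0 < N3) (hN4 : 0 < N4)
    (lam2 lam4 : ℝ) (hlam2 : 0 < lam2) (hlam4 : 0 < lam4)
    (γth : ℝ) (hγth : 0 ≤ γth)
    (mSR mRD : ℝ) (hmSR : 0 < mSR) (hmRD : 0 < mRD)
    (ρSR ρRD ΩSR ΩRD σεSR σεRD σwSR σwRD : ℝ)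
    (hρSR : ρSR ∈ Set.Icc (0:ℝ) 1) (hρRD : ρRD ∈ Set.Icc (0:ℝ) 1)
    (hΩSR : 0 < ΩSR) (hΩRD : 0 < ΩRD)
    (hσεSR : 0 ≤ σεSR) (hσεRD : 0 ≤ σεRD) (hσwSR : 0 ≤ σwSR) (hσwRD : 0 ≤ σwRD)
    (hposSR : 0 < ρSR ^ 2 * σεSR + (1 - ρSR ^ 2) * σwSR)
    (hposRD : 0 < ρRD ^ 2 * σεRD + (1 - ρRD ^ 2) * σwRD)
    (ΥSR ΥRD : ℝ → ℝ) (ΞSR ΞRD : ℝ)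
    (hΥSR : ΥSR = fun δ =>
      ρSR ^ 2 * δ / ((δ / ΩSR) * (ρSR ^ 2 * σεSR + (1 - ρSR ^ 2) * σwSR) + 1))
    (hΥRD : ΥRD = fun δ =>
      ρRD ^ 2 * δ / ((δ / ΩRD) * (ρRD ^ 2 * σεRD + (1 - ρRD ^ 2) * σwRD) + 1))
    (hΞSR : ΞSR = ρSR ^ 2 * ΩSR / (ρSR ^ 2 * σεSR + (1 - ρSR ^ 2) * σwSR))
    (hΞRD : ΞRD = ρRD ^ 2 * ΩRD / (ρRD ^ 2 * σεRD + (1 - ρRD ^ 2) * σwRD))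
    (Pint : ℝ → ℝ) (Pinf : ℝ)
    (hPint : Pint = fun δ =>
      1 - ((Measure.pi (fun i : Fin 4 =>
              gammaMeasure (![N1, N2, N3, N4] i)
                (![mSR / ΥSR δ, lam2, mRD / ΥRD δ, lam4] i)))
            {x | x 0 > γth ∧ x 0 > x 1 ∧ x 0 > x 3 ∧ x 2 > x 3}).toReal)
    (hPinf : Pinf =
      1 - ((Measure.pi (fun i : Fin 4 =>
              gammaMeasure (![N1, N2, N3, N4] i)
                (![mSR / ΞSR, lam2, mRD / ΞRD, lam4] i)))
            {x | x 0 > γth ∧ x 0 > x 1 ∧ x 0 > x 3 ∧ x 2 > x 3}).toReal) :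
    Tendsto Pint atTop (𝓝 Pinf) ∧ ¬ Tendsto Pint atTop (𝓝 0) := by
  set a : Fin 4 → ℝ := ![N1, N2, N3, N4]
  set r₀ : Fin 4 → ℝ := ![mSR / ΞSR, lam2, mRD / ΞRD, lam4]
  set S : Set (Fin 4 → ℝ) := {x | x 0 > γth ∧ x 0 > x 1 ∧ x 0 > x 3 ∧ x 2 > x 3}
  have ha : ∀ i, 0 < a i := by
    intro i
    fin_cases i <;> assumption
  obtain ⟨hSR0, hSRlim, hSRbd⟩ := effective_rate_asymptotics (ρ := ρSR) hmSR hΩSR hposSR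
  obtain ⟨hRD0, hRDlim, hRDbd⟩ := effective_rate_asymptotics (ρ := ρRD) hmRD hΩRD hposRD
  rw [← hΞSR] at hSR0 hSRlim hSRbd
  rw [← hΞRD] at hRD0 hRDlim hRDbd
  have hr₀ : ∀ i, 0 ≤ r₀ i := by
    intro i
    fin_cases i
    exacts [hSR0, hlam2.le, hRD0, hlam4.le]
  have hS : MeasurableSet S := by
    have hlt (i j : Fin 4) : MeasurableSet {x : Fin 4 → ℝ | x i > x j} :=
      measurableSet_lt (measurable_pi_apply j) (measurable_pi_apply i)
    exact (measurableSet_lt measurable_const (measurable_pi_apply 0)).inter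
      ((hlt 0 1).inter ((hlt 0 3).inter (hlt 2 3)))
  have hlt : Measure.pi (fun i => gammaMeasure (a i) (r₀ i)) S < 1 :=
    (measure_mono fun x hx => hx.2.1).trans_lt
      (pi_gammaMeasure_gt_lt_one ha hr₀ (i := 0) (j := 1) (by decide))
  have hlim : Tendsto Pint atTop (𝓝 Pinf) := by
    rw [hPint, hPinf]
    refine tendsto_const_nhds.sub ((ENNReal.tendsto_toReal hlt.ne_top).comp
      (tendsto_pi_gammaMeasure_apply ha hr₀ (fun i => ?_) ?_ hS))
    · subst hΥSR hΥRD
      fin_cases i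
      exacts [hSRlim, tendsto_const_nhds, hRDlim, tendsto_const_nhds]
    · subst hΥSR hΥRD
      filter_upwards [hSRbd, hRDbd] with δ h1 h2 i
      fin_cases i
      exacts [h1, ⟨le_rfl, show lam2 ≤ 2 * lam2 by linarith⟩, h2,
        ⟨le_rfl, show lam4 ≤ 2 * lam4 by linarith⟩]
  have hpos : 0 < Pinf := by
    rw [hPinf, sub_pos]
    simpa using (ENNReal.toReal_lt_toReal hlt.ne_top ENNReal.one_ne_top).2 hlt
  exact ⟨hlim, fun h => hpos.ne' (tendsto_nhds_unique hlim h)⟩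
end
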